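/- Let X be a square-integrable real-valued random variable with continuous distribution function F(·;X) and quantile function Q(·;X). Then Q(·;X) ∈ L²((0,1), Lebesgue) and it has the LP representation Q(u;X) = ∑_{j≥0} LP(j;X) · Leg_j(u), with the series converging in L²((0,1)), where LP(j;X) = E[X · Leg_j(F(X;X))] = ∫₀¹ Q(u;X) Leg_j(u) du and LP(0;X) = E[X]. -/

import Mathlib

open MeasureTheory Set Filter

/-- The `j`-th orthonormal shifted Legendre polynomial on `[0,1]` (Rodrigues'
formula), the result of Gram–Schmidt orthonormalization of `1, u, u², …` in
`L²([0,1])`. In particular `Leg 0 = 1` and `Leg 1 u = √12 (u − 1/2)`. -/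
noncomputable def Leg (j : ℕ) (u : ℝ) : ℝ :=
  (Real.sqrt (2 * j + 1) / j.factorial) * iteratedDeriv j (fun x => (x ^ 2 - x) ^ j) u

/-- The distribution function `F(x;X) = P(X ≤ x)`. -/
noncomputable def distFun {Ω : Type*} [MeasurableSpace Ω] (P : Measure Ω)
    (X : Ω → ℝ) (x : ℝ) : ℝ :=
  (P (X ⁻¹' Iic x)).toReal

/-- The quantile function `Q(u;X) = inf {x : F(x;X) ≥ u}`. -/
noncomputable def quantileFun {Ω : Type*} [MeasurableSpace Ω] (P : Measure Ω)
    (X : Ω → ℝ) (u : ℝ) : ℝ :=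
  sInf {x : ℝ | u ≤ distFun P X x}

/-- The LP moment `LP(j;X) = E[X · Leg_j(F(X;X))]`. -/
noncomputable def LPmom {Ω : Type*} [MeasurableSpace Ω] (P : Measure Ω)
    (X : Ω → ℝ) (j : ℕ) : ℝ :=
  ∫ ω, X ω * Leg j (distFun P X (X ω)) ∂P

open Polynomial in
/-- The shifted Legendre polynomial `Leg j` as an element of `ℝ[X]`. -/
noncomputable def legPoly (j : ℕ) : ℝ[X] :=
  C (Real.sqrt (2 * j + 1) / j.factorial) * derivative^[j] ((X ^ 2 - X) ^ j)

section Legendre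

open Polynomial

theorem iteratedDeriv_polynomial_eval (p : ℝ[X]) (n : ℕ) :
    iteratedDeriv n (fun x => p.eval x) = fun x => (derivative^[n] p).eval x := by
  induction n with
  | zero => simp
  | succ n ih =>
    rw [iteratedDeriv_succ, ih, Function.iterate_succ_apply']
    ext x
    exact Polynomial.deriv _

theorem Leg_eq_eval (j : ℕ) (u : ℝ) : Leg j u = (legPoly j).eval u := by
  have h := congrFun (iteratedDeriv_polynomial_eval ((X ^ 2 - X) ^ j) j) u
  simp only [eval_pow, eval_sub, eval_X] at h
  simp only [Leg, legPoly, eval_mul, eval_C, h]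

theorem monic_X_sq_sub_X_pow (j : ℕ) : ((X ^ 2 - X : ℝ[X]) ^ j).Monic := by
  apply Monic.pow
  monicity!

theorem natDegree_X_sq_sub_X_pow (j : ℕ) : ((X ^ 2 - X : ℝ[X]) ^ j).natDegree = 2 * j := by
  rw [natDegree_pow, show (X ^ 2 - X : ℝ[X]).natDegree = 2 by compute_degree!, mul_comm]

theorem degree_legPoly (j : ℕ) : (legPoly j).degree = j := by
  have hc : Real.sqrt (2 * j + 1) / j.factorial ≠ 0 := by positivity
  rw [legPoly, degree_C_mul hc]
  refine degree_eq_of_le_of_coeff_ne_zero ?_ ?_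
  · refine degree_le_of_natDegree_le ((natDegree_iterate_derivative _ _).trans ?_)
    rw [natDegree_X_sq_sub_X_pow]
    omega
  · have h : ((X ^ 2 - X : ℝ[X]) ^ j).coeff (j + j) = 1 := by
      have := (monic_X_sq_sub_X_pow j).coeff_natDegree
      rwa [natDegree_X_sq_sub_X_pow, two_mul] at this
    rw [coeff_iterate_derivative, h, nsmul_eq_mul, mul_one]
    exact_mod_cast (Nat.descFactorial_pos.2 (by omega)).ne'

theorem span_range_legPoly : Submodule.span ℝ (Set.range legPoly) = ⊤ :=
  (Polynomial.Sequence.mk legPoly degree_legPoly).span fun i =>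
    isUnit_iff_ne_zero.2 (leadingCoeff_ne_zero.2 (Polynomial.Sequence.ne_zero _ i))

theorem integral_mul_derivative_eq_neg (p q : ℝ[X]) (h0 : q.eval 0 = 0) (h1 : q.eval 1 = 0) :
    ∫ x in (0 : ℝ)..1, p.eval x * (derivative q).eval x =
      -∫ x in (0 : ℝ)..1, (derivative p).eval x * q.eval x := by
  rw [intervalIntegral.integral_mul_deriv_eq_deriv_mul (fun x _ => p.hasDerivAt x)
    (fun x _ => q.hasDerivAt x) (Continuous.intervalIntegrable (by fun_prop) _ _)
    (Continuous.intervalIntegrable (by fun_prop) _ _), h0, h1]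
  ring

theorem eval_iterate_derivative_X_sq_sub_X_pow {m j : ℕ} (h : m < j) {a : ℝ}
    (ha : a ^ 2 - a = 0) : (derivative^[m] ((X ^ 2 - X : ℝ[X]) ^ j)).eval a = 0 := by
  obtain ⟨r, hr⟩ := pow_sub_dvd_iterate_derivative_of_pow_dvd m
    (dvd_refl ((X ^ 2 - X : ℝ[X]) ^ j))
  rw [hr]
  simp [ha, Nat.sub_ne_zero_of_lt h]

theorem integral_mul_iterate_derivative (p : ℝ[X]) {k j : ℕ} (h : k ≤ j) :
    ∫ x in (0 : ℝ)..1, p.eval x * (derivative^[j] ((X ^ 2 - X : ℝ[X]) ^ j)).eval x =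
      (-1) ^ k * ∫ x in (0 : ℝ)..1, (derivative^[k] p).eval x *
        (derivative^[j - k] ((X ^ 2 - X : ℝ[X]) ^ j)).eval x := by
  induction k with
  | zero => simp
  | succ k ih =>
    rw [ih (by omega), show j - k = (j - (k + 1)) + 1 by omega,
      Function.iterate_succ_apply' derivative (j - (k + 1)), integral_mul_derivative_eq_neg,
      Function.iterate_succ_apply' derivative k]
    · ring
    all_goals exact eval_iterate_derivative_X_sq_sub_X_pow (by omega) (by norm_num)

theorem integral_X_sq_sub_X_pow (j : ℕ) :
    ∫ x in (0 : ℝ)..1, (x ^ 2 - x) ^ j =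
      (-1) ^ j * (j.factorial : ℝ) ^ 2 / ((2 * j + 1).factorial : ℝ) := by
  induction j with
  | zero => simp
  | succ j ih =>
    have hd : ∀ x : ℝ, HasDerivAt (fun x : ℝ => (2 * x - 1) * (x ^ 2 - x) ^ (j + 1))
        ((4 * j + 6) * (x ^ 2 - x) ^ (j + 1) + (j + 1) * (x ^ 2 - x) ^ j) x := by
      intro x
      have h1 : HasDerivAt (fun x : ℝ => 2 * x - 1) 2 x := by
        simpa using ((hasDerivAt_id x).const_mul 2).sub_const 1
      have h2 : HasDerivAt (fun x : ℝ => x ^ 2 - x) (2 * x - 1) x := by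
        simpa using (hasDerivAt_pow 2 x).fun_sub (hasDerivAt_id' x)
      refine (h1.fun_mul (h2.fun_pow (j + 1))).congr_deriv ?_
      rw [Nat.add_sub_cancel]
      push_cast
      ring
    have hftc := intervalIntegral.integral_eq_sub_of_hasDerivAt (a := 0) (b := 1)
      (fun x _ => hd x) (Continuous.intervalIntegrable (by fun_prop) _ _)
    rw [intervalIntegral.integral_add (Continuous.intervalIntegrable (by fun_prop) _ _)
      (Continuous.intervalIntegrable (by fun_prop) _ _), intervalIntegral.integral_const_mul,
      intervalIntegral.integral_const_mul, ih] at hftc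
    norm_num at hftc
    have hf : (((2 * (j + 1) + 1).factorial : ℕ) : ℝ) =
        (2 * j + 3) * ((2 * j + 2) * (2 * j + 1).factorial) := by
      rw [show 2 * (j + 1) + 1 = (2 * j + 1) + 1 + 1 by ring, Nat.factorial_succ,
        Nat.factorial_succ]
      push_cast
      ring
    have hf0 : ((2 * j + 1).factorial : ℝ) ≠ 0 := by positivity
    rw [hf, Nat.factorial_succ]
    have h6 : (4 * j + 6 : ℝ) ≠ 0 := by positivity
    apply mul_left_cancel₀ h6
    rw [eq_neg_of_add_eq_zero_left hftc]
    push_cast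
    field_simp
    ring

theorem integral_legPoly_mul_of_lt {i j : ℕ} (h : i < j) :
    ∫ x in (0 : ℝ)..1, (legPoly i).eval x * (legPoly j).eval x = 0 := by
  have hz : derivative^[j] (legPoly i) = 0 :=
    iterate_derivative_eq_zero_of_degree_lt (by rw [degree_legPoly]; exact_mod_cast h)
  have := integral_mul_iterate_derivative (legPoly i) (le_refl j)
  simp only [hz, eval_zero, zero_mul, intervalIntegral.integral_zero, mul_zero] at this
  conv_lhs => enter [1, x]; rw [legPoly.eq_def j, eval_mul, eval_C, mul_left_comm]
  rw [intervalIntegral.integral_const_mul, this, mul_zero]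

theorem integral_legPoly_mul_self (j : ℕ) :
    ∫ x in (0 : ℝ)..1, (legPoly j).eval x * (legPoly j).eval x = 1 := by
  have hD : derivative^[j] (derivative^[j] ((X ^ 2 - X : ℝ[X]) ^ j)) =
      C ((2 * j).factorial : ℝ) := by
    rw [← Function.iterate_add_apply, ← two_mul]
    have hdeg : (derivative^[2 * j] ((X ^ 2 - X : ℝ[X]) ^ j)).natDegree = 0 := by
      have := natDegree_iterate_derivative ((X ^ 2 - X : ℝ[X]) ^ j) (2 * j)
      rw [natDegree_X_sq_sub_X_pow] at this
      omega
    rw [eq_C_of_natDegree_eq_zero hdeg, coeff_iterate_derivative, zero_add]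
    have := (monic_X_sq_sub_X_pow j).coeff_natDegree
    rw [natDegree_X_sq_sub_X_pow] at this
    rw [this, Nat.descFactorial_self, nsmul_eq_mul, mul_one]
  have key := integral_mul_iterate_derivative (derivative^[j] ((X ^ 2 - X : ℝ[X]) ^ j)) (le_refl j)
  simp only [hD, Nat.sub_self, Function.iterate_zero_apply, eval_C, eval_pow, eval_sub, eval_X,
    intervalIntegral.integral_const_mul, integral_X_sq_sub_X_pow] at key
  simp only [legPoly, eval_mul, eval_C, mul_mul_mul_comm,
    intervalIntegral.integral_const_mul, key]
  have hs : Real.sqrt (2 * j + 1) ^ 2 = 2 * j + 1 := Real.sq_sqrt (by positivity)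
  have hm : ((-1 : ℝ) ^ j) ^ 2 = 1 := by rw [← pow_mul, mul_comm, pow_mul]; simp
  rw [Nat.factorial_succ]
  push_cast
  have hf0 : ((2 * j).factorial : ℝ) ≠ 0 := by positivity
  have hf1 : (j.factorial : ℝ) ≠ 0 := by positivity
  have hf2 : (2 * j + 1 : ℝ) ≠ 0 := by positivity
  field_simp
  rw [hs, hm]
  ring

end Legendre

section LegendreBasis

open Polynomial

theorem memLp_polynomial_eval (p : ℝ[X]) :
    MemLp (fun x => p.eval x) 2 (volume.restrict (Ioo (0 : ℝ) 1)) := by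
  obtain ⟨C, hC⟩ := isCompact_Icc.exists_bound_of_continuousOn (s := Icc (0 : ℝ) 1)
    (f := fun x => p.eval x) (by fun_prop)
  refine MemLp.of_bound (Continuous.aestronglyMeasurable (by fun_prop)) C ?_
  filter_upwards [ae_restrict_mem measurableSet_Ioo] with x hx using hC x (Ioo_subset_Icc_self hx)

/-- The class in `L²((0,1))` of a real polynomial, as a linear map. -/
noncomputable def polynomialToLp :
    ℝ[X] →ₗ[ℝ] Lp ℝ 2 (volume.restrict (Ioo (0 : ℝ) 1)) where
  toFun p := (memLp_polynomial_eval p).toLp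
  map_add' p q := by
    rw [← MemLp.toLp_add]
    congr 1
    ext x
    simp
  map_smul' c p := by
    rw [RingHom.id_apply, ← MemLp.toLp_const_smul]
    congr 1
    ext x
    simp

theorem inner_polynomialToLp {f : ℝ → ℝ} (hf : MemLp f 2 (volume.restrict (Ioo (0 : ℝ) 1)))
    (p : ℝ[X]) :
    inner ℝ (polynomialToLp p) hf.toLp = ∫ u in Ioo (0 : ℝ) 1, f u * p.eval u := by
  rw [L2.inner_def]
  apply integral_congr_ae
  filter_upwards [(memLp_polynomial_eval p).coeFn_toLp, hf.coeFn_toLp] with x h1 h2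
  rw [h2, show (polynomialToLp p) x = p.eval x from h1]
  simp

theorem orthonormal_legPoly : Orthonormal ℝ fun j => polynomialToLp (legPoly j) := by
  have hI : ∀ i j, inner ℝ (polynomialToLp (legPoly i)) (polynomialToLp (legPoly j)) =
      ∫ x in (0 : ℝ)..1, (legPoly i).eval x * (legPoly j).eval x := by
    intro i j
    rw [intervalIntegral.integral_of_le zero_le_one, integral_Ioc_eq_integral_Ioo]
    exact (inner_polynomialToLp (memLp_polynomial_eval (legPoly j)) (legPoly i)).trans
      (by simp only [mul_comm])
  rw [orthonormal_iff_ite]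
  intro i j
  rw [hI]
  split_ifs with h
  · rw [h, integral_legPoly_mul_self]
  · rcases lt_or_gt_of_ne h with h | h
    · exact integral_legPoly_mul_of_lt h
    · simpa only [mul_comm] using integral_legPoly_mul_of_lt h

theorem dense_range_polynomialToLp : DenseRange polynomialToLp := by
  intro f
  rw [Metric.mem_closure_range_iff]
  intro ε hε
  have hf := Lp.memLp f
  obtain ⟨g, -, hfg, hg, hgm⟩ := hf.exists_hasCompactSupport_eLpNorm_sub_le (by simp)
    (ε := ENNReal.ofReal (ε / 4)) (by simpa using hε)
  obtain ⟨p, hp⟩ := exists_polynomial_near_of_continuousOn 0 1 g hg.continuousOn (ε / 4)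
    (by positivity)
  refine ⟨p, ?_⟩
  have hgp : eLpNorm (g - fun x => p.eval x) 2 (volume.restrict (Ioo (0 : ℝ) 1)) ≤
      ENNReal.ofReal (ε / 4) := by
    refine (eLpNorm_le_of_ae_bound (C := ε / 4) ?_).trans (by simp)
    filter_upwards [ae_restrict_mem measurableSet_Ioo] with x hx
    rw [Pi.sub_apply, norm_sub_rev]
    exact (hp x (Ioo_subset_Icc_self hx)).le
  have hsum : eLpNorm (⇑f - fun x => p.eval x) 2 (volume.restrict (Ioo (0 : ℝ) 1)) ≤
      ENNReal.ofReal (ε / 2) := by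
    have h := eLpNorm_add_le (hf.1.sub hgm.1) (hgm.1.sub (memLp_polynomial_eval p).1)
      (one_le_two : (1 : ENNReal) ≤ 2)
    rw [sub_add_sub_cancel] at h
    refine h.trans ((add_le_add hfg hgp).trans ?_)
    rw [← ENNReal.ofReal_add (by positivity) (by positivity)]
    apply le_of_eq
    congr 1
    ring
  have hd : edist f (polynomialToLp p) ≤ ENNReal.ofReal (ε / 2) := by
    have h := Lp.edist_toLp_toLp _ _ hf (memLp_polynomial_eval p)
    rw [Lp.toLp_coeFn] at h
    exact h.trans_le hsum
  rw [edist_dist, ENNReal.ofReal_le_ofReal_iff (by positivity)] at hd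
  linarith

/-- The shifted Legendre polynomials as a Hilbert basis of `L²((0,1))`. -/
noncomputable def legendreBasis :
    HilbertBasis ℕ ℝ (Lp ℝ 2 (volume.restrict (Ioo (0 : ℝ) 1))) :=
  HilbertBasis.mk orthonormal_legPoly <| by
    rw [show (fun j => polynomialToLp (legPoly j)) = polynomialToLp ∘ legPoly from rfl,
      Set.range_comp, Submodule.span_image, span_range_legPoly, Submodule.map_top]
    refine (Submodule.dense_iff_topologicalClosure_eq_top.1 ?_).ge
    rw [LinearMap.coe_range]
    exact dense_range_polynomialToLp

theorem tendsto_eLpNorm_sub_sum_Leg {f : ℝ → ℝ}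
    (hf : MemLp f 2 (volume.restrict (Ioo (0 : ℝ) 1))) :
    Tendsto (fun n => eLpNorm (fun u => f u - ∑ j ∈ Finset.range n,
        (∫ v in Ioo (0 : ℝ) 1, f v * Leg j v) * Leg j u) 2 (volume.restrict (Ioo (0 : ℝ) 1)))
      atTop (nhds 0) := by
  have h := (legendreBasis.hasSum_repr hf.toLp).tendsto_sum_nat
  rw [tendsto_iff_edist_tendsto_0] at h
  refine h.congr fun n => ?_
  have hsum : ∑ i ∈ Finset.range n, legendreBasis.repr hf.toLp i • legendreBasis i =
      polynomialToLp (∑ j ∈ Finset.range n,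
        (∫ v in Ioo (0 : ℝ) 1, f v * Leg j v) • legPoly j) := by
    rw [map_sum]
    refine Finset.sum_congr rfl fun j _ => ?_
    rw [map_smul, legendreBasis.repr_apply_apply, legendreBasis, HilbertBasis.coe_mk,
      inner_polynomialToLp]
    simp only [Leg_eq_eval]
  rw [hsum, edist_comm]
  refine (Lp.edist_toLp_toLp _ _ hf (memLp_polynomial_eval _)).trans ?_
  congr 1
  ext u
  simp [eval_finsetSum, Leg_eq_eval]

end LegendreBasis

section Quantile

variable {Ω : Type*} [MeasurableSpace Ω] {P : Measure Ω} {X : Ω → ℝ}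

theorem distFun_eq_cdf [IsProbabilityMeasure P] (hX : Measurable X) :
    distFun P X = ProbabilityTheory.cdf (P.map X) := by
  have := Measure.isProbabilityMeasure_map (μ := P) hX.aemeasurable
  ext x
  rw [ProbabilityTheory.cdf_eq_real, measureReal_def, Measure.map_apply hX measurableSet_Iic,
    distFun]

theorem bddBelow_le_distFun [IsProbabilityMeasure P] (hX : Measurable X) {u : ℝ} (hu : 0 < u) :
    BddBelow {x : ℝ | u ≤ distFun P X x} := by
  rw [distFun_eq_cdf hX]
  obtain ⟨a, ha⟩ := ((ProbabilityTheory.tendsto_cdf_atBot (P.map X)).eventually_lt_const hu).exists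
  refine ⟨a, fun x hx => ?_⟩
  by_contra! h
  exact absurd (hx.trans (ProbabilityTheory.monotone_cdf _ h.le)) ha.not_ge

theorem nonempty_le_distFun [IsProbabilityMeasure P] (hX : Measurable X) {u : ℝ} (hu : u < 1) :
    {x : ℝ | u ≤ distFun P X x}.Nonempty := by
  rw [distFun_eq_cdf hX]
  obtain ⟨a, ha⟩ := ((ProbabilityTheory.tendsto_cdf_atTop (P.map X)).eventually_const_lt hu).exists
  exact ⟨a, ha.le⟩

theorem le_distFun_quantileFun [IsProbabilityMeasure P] (hX : Measurable X)
    (hF : Continuous (distFun P X)) {u : ℝ} (hu : u ∈ Ioo (0 : ℝ) 1) :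
    u ≤ distFun P X (quantileFun P X u) :=
  (isClosed_le continuous_const hF).csInf_mem (nonempty_le_distFun hX hu.2)
    (bddBelow_le_distFun hX hu.1)

theorem quantileFun_le_iff [IsProbabilityMeasure P] (hX : Measurable X)
    (hF : Continuous (distFun P X)) {u : ℝ} (hu : u ∈ Ioo (0 : ℝ) 1) (x : ℝ) :
    quantileFun P X u ≤ x ↔ u ≤ distFun P X x := by
  refine ⟨fun h => (le_distFun_quantileFun hX hF hu).trans ?_,
    fun h => csInf_le (bddBelow_le_distFun hX hu.1) h⟩
  rw [distFun_eq_cdf hX]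
  exact ProbabilityTheory.monotone_cdf _ h

theorem distFun_quantileFun [IsProbabilityMeasure P] (hX : Measurable X)
    (hF : Continuous (distFun P X)) {u : ℝ} (hu : u ∈ Ioo (0 : ℝ) 1) :
    distFun P X (quantileFun P X u) = u := by
  refine le_antisymm ?_ (le_distFun_quantileFun hX hF hu)
  refine le_of_tendsto (hF.continuousWithinAt (s := Iio (quantileFun P X u))) ?_
  filter_upwards [self_mem_nhdsWithin] with x hx
  exact (not_le.1 (mt (quantileFun_le_iff hX hF hu x).2 (not_le.2 hx))).le

theorem aemeasurable_quantileFun [IsProbabilityMeasure P] (hX : Measurable X)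
    (hF : Continuous (distFun P X)) :
    AEMeasurable (quantileFun P X) (volume.restrict (Ioo (0 : ℝ) 1)) := by
  refine aemeasurable_restrict_of_monotoneOn measurableSet_Ioo fun u hu v hv huv => ?_
  rw [quantileFun_le_iff hX hF hu, distFun_quantileFun hX hF hv]
  exact huv

theorem map_quantileFun [IsProbabilityMeasure P] (hX : Measurable X)
    (hF : Continuous (distFun P X)) :
    (volume.restrict (Ioo (0 : ℝ) 1)).map (quantileFun P X) = P.map X := by
  have hQ := aemeasurable_quantileFun hX hF
  have := Measure.isProbabilityMeasure_map (μ := P) hX.aemeasurable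
  refine Measure.ext_of_Iic _ _ fun x => ?_
  have h1 : distFun P X x ≤ 1 := by
    rw [distFun_eq_cdf hX]
    exact ProbabilityTheory.cdf_le_one _ x
  have hae : quantileFun P X ⁻¹' Iic x =ᵐ[volume.restrict (Ioo (0 : ℝ) 1)]
      Iic (distFun P X x) := by
    filter_upwards [ae_restrict_mem measurableSet_Ioo] with u hu
    exact propext (quantileFun_le_iff hX hF hu x)
  rw [Measure.map_apply_of_aemeasurable hQ measurableSet_Iic, measure_congr hae,
    restrict_Ioo_eq_restrict_Ioc, Measure.restrict_apply measurableSet_Iic, inter_comm,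
    Ioc_inter_Iic, min_eq_right h1, Real.volume_Ioc, sub_zero, distFun_eq_cdf hX,
    ProbabilityTheory.ofReal_cdf]

theorem memLp_quantileFun [IsProbabilityMeasure P] (hX : Measurable X)
    (hF : Continuous (distFun P X)) {p : ENNReal} (hXp : MemLp X p P) :
    MemLp (quantileFun P X) p (volume.restrict (Ioo (0 : ℝ) 1)) := by
  have h : MemLp id p (P.map X) :=
    (memLp_map_measure_iff aestronglyMeasurable_id hX.aemeasurable).2 hXp
  rw [← map_quantileFun hX hF] at h
  exact (memLp_map_measure_iff aestronglyMeasurable_id (aemeasurable_quantileFun hX hF)).1 h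

theorem LPmom_eq_integral_quantileFun [IsProbabilityMeasure P] (hX : Measurable X)
    (hF : Continuous (distFun P X)) (j : ℕ) :
    LPmom P X j = ∫ u in Ioo (0 : ℝ) 1, quantileFun P X u * Leg j u := by
  have hL : Continuous (Leg j) := by
    simp only [funext (Leg_eq_eval j)]
    fun_prop
  have hc : Continuous fun x => x * Leg j (distFun P X x) := by fun_prop
  calc LPmom P X j = ∫ x, x * Leg j (distFun P X x) ∂(P.map X) :=
        (integral_map hX.aemeasurable hc.aestronglyMeasurable).symm
    _ = ∫ u in Ioo (0 : ℝ) 1,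
          quantileFun P X u * Leg j (distFun P X (quantileFun P X u)) := by
        rw [← map_quantileFun hX hF,
          integral_map (aemeasurable_quantileFun hX hF) hc.aestronglyMeasurable]
    _ = ∫ u in Ioo (0 : ℝ) 1, quantileFun P X u * Leg j u :=
        setIntegral_congr_fun measurableSet_Ioo fun u hu => by
          simp only [distFun_quantileFun hX hF hu]

end Quantile

/-- (LP representation of the quantile function.) For a square
integrable `X` with continuous distribution function, `Q(·;X) ∈ L²((0,1))`,
`Q(u;X) = ∑_{j≥0} LP(j;X)·Leg_j(u)` with convergence in `L²((0,1))`, the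
coefficients satisfy `LP(j;X) = ∫₀¹ Q(u;X) Leg_j(u) du`, and `LP(0;X) = E[X]`. -/
theorem quantile_LP_representation {Ω : Type*} [MeasurableSpace Ω]
    (P : Measure Ω) [IsProbabilityMeasure P] (X : Ω → ℝ) (hX : Measurable X)
    (hF : Continuous (distFun P X)) (hX2 : MemLp X 2 P) :
    MemLp (quantileFun P X) 2 (volume.restrict (Ioo (0 : ℝ) 1)) ∧
    Tendsto
      (fun n => eLpNorm
        (fun u => quantileFun P X u - ∑ j ∈ Finset.range (n + 1), LPmom P X j * Leg j u)
        2 (volume.restrict (Ioo (0 : ℝ) 1)))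
      atTop (nhds 0) ∧
    (∀ j : ℕ, LPmom P X j = ∫ u in Ioo (0 : ℝ) 1, quantileFun P X u * Leg j u) ∧
    LPmom P X 0 = ∫ ω, X ω ∂P := by
  have hQ := memLp_quantileFun hX hF hX2
  have hc := LPmom_eq_integral_quantileFun hX hF
  refine ⟨hQ, ?_, hc, ?_⟩
  · simp only [hc]
    exact (tendsto_eLpNorm_sub_sum_Leg hQ).comp (tendsto_add_atTop_nat 1)
  · simp [LPmom, Leg]
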